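/- Deterministic ℓ₁ and prediction error bounds for the SOFAR estimator (bounds (d) and (e) of Theorem 2, deterministic core): Let X be a real n×p matrix. Let Ĉ, C* be real p×q matrices and set Δ = Ĉ − C*; let D̂, D* (diagonal q×q), Â, A* (p×q), B̂, B* (q×q) be matrices and set Δ_d = D̂ − D*, Δ_a = Â − A*, Δ_b = B̂ − B*. Let η, λ, c₂, τ > 0 and assume: (H1) ‖Δ_a‖_F + ‖Δ_b‖_F + ‖Δ_d‖_F ≤ η‖Δ‖_F; (H2) c₂‖Δ‖_F² ≤ n⁻¹‖XΔ‖_F²; (H3) n⁻¹‖XΔ‖_F² ≤ λ(‖Δ_d‖₁ + ‖Δ_a‖₁ + ‖Δ_b‖₁); (H4) every entry of each of D̂, D*, Â, A*, B̂, B* is either zero or has absolute value at least τ; and (H5) x := λ²η⁴/(c₂²τ²) < 1. Then, with s₀ = ‖D*‖₀ + ‖A*‖₀ + ‖B*‖₀, one has ‖Δ_d‖₁ + ‖Δ_a‖₁ + ‖Δ_b‖₁ ≤ λη²s₀/(c₂(1 − x)) and n⁻¹‖XΔ‖_F² ≤ λ²η²s₀/(c₂(1 − x)). -/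

import Mathlib

open Matrix BigOperators

/-- Frobenius norm of a real matrix. -/
noncomputable def frobNorm {m n : ℕ} (M : Matrix (Fin m) (Fin n) ℝ) : ℝ :=
  Real.sqrt (∑ i, ∑ j, (M i j) ^ 2)

/-- Entrywise ℓ₁-norm of a real matrix. -/
noncomputable def l1Norm {m n : ℕ} (M : Matrix (Fin m) (Fin n) ℝ) : ℝ :=
  ∑ i, ∑ j, |M i j|

/-- Number of nonzero entries of a real matrix. -/
noncomputable def l0Norm {m n : ℕ} (M : Matrix (Fin m) (Fin n) ℝ) : ℕ :=
  Nat.card {ij : Fin m × Fin n // M ij.1 ij.2 ≠ 0}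

/-- Every entry of `M` is either zero or at least `τ` in absolute value. -/
def Thresholded {m n : ℕ} (τ : ℝ) (M : Matrix (Fin m) (Fin n) ℝ) : Prop :=
  ∀ i j, M i j = 0 ∨ τ ≤ |M i j|

lemma frobNorm_sq {m n : ℕ} (M : Matrix (Fin m) (Fin n) ℝ) :
    frobNorm M ^ 2 = ∑ i, ∑ j, (M i j) ^ 2 :=
  Real.sq_sqrt (Finset.sum_nonneg fun _ _ => Finset.sum_nonneg fun _ _ => sq_nonneg _)

lemma l0Norm_eq {m n : ℕ} (M : Matrix (Fin m) (Fin n) ℝ) :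
    (l0Norm M : ℝ) = ∑ i, ∑ j, (if M i j ≠ 0 then (1 : ℝ) else 0) := by
  classical
  rw [← Fintype.sum_prod_type' (f := fun i j => if M i j ≠ 0 then (1 : ℝ) else 0)]
  unfold l0Norm
  rw [Nat.card_eq_fintype_card, Fintype.card_subtype, Finset.sum_boole]

/-- Entrywise AM-GM bound, summed over the matrix. -/
lemma l1_key {m n : ℕ} (H S : Matrix (Fin m) (Fin n) ℝ) (t τ : ℝ) (ht : 0 < t) (hτ : 0 < τ)
    (hH : Thresholded τ H) :
    2 * l1Norm (H - S) ≤ t * l0Norm S + (t / τ ^ 2 + 1 / t) * frobNorm (H - S) ^ 2 := by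
  rw [frobNorm_sq, l0Norm_eq, l1Norm]
  simp only [Finset.mul_sum]
  simp only [← Finset.sum_add_distrib]
  refine Finset.sum_le_sum fun i _ => Finset.sum_le_sum fun j _ => ?_
  rw [Matrix.sub_apply]
  have amgm : ∀ d : ℝ, 2 * |d| ≤ t + 1 / t * d ^ 2 := by
    intro d
    have h : 0 ≤ (t - |d|) ^ 2 / t := by positivity
    have e : (t - |d|) ^ 2 / t = t + 1 / t * d ^ 2 - 2 * |d| := by
      rw [← sq_abs d]; field_simp; ring
    linarith
  have h1 := amgm (H i j - S i j)
  have hp : 0 ≤ t / τ ^ 2 * (H i j - S i j) ^ 2 := by positivity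
  by_cases hS : S i j = 0
  · rcases hH i j with h0 | h0
    · simp [hS, h0]
    · have h2 : τ ^ 2 ≤ (H i j) ^ 2 := by
        rw [← sq_abs (H i j)]; gcongr
      have h3 : t ≤ t / τ ^ 2 * (H i j) ^ 2 := by
        calc t = t / τ ^ 2 * τ ^ 2 := by field_simp
          _ ≤ _ := by gcongr
      simp only [hS, sub_zero, ne_eq, not_true_eq_false, if_false] at h1 ⊢
      linarith
  · simp only [hS, ne_eq, not_false_eq_true, if_true]
    linarith

/-- Deterministic ℓ₁ and prediction error bounds for the SOFAR estimator (bounds (d) and (e)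
of Theorem 2, deterministic core). -/
theorem sofar_l1_and_prediction_error_bounds {n p q : ℕ}
    (X : Matrix (Fin n) (Fin p) ℝ)
    (Chat Cstar : Matrix (Fin p) (Fin q) ℝ)
    (Dhat Dstar : Matrix (Fin q) (Fin q) ℝ) (hDhatDiag : Dhat.IsDiag)
    (hDstarDiag : Dstar.IsDiag)
    (Ahat Astar : Matrix (Fin p) (Fin q) ℝ)
    (Bhat Bstar : Matrix (Fin q) (Fin q) ℝ)
    (η lam c2 τ : ℝ) (hη : 0 < η) (hlam : 0 < lam) (hc2 : 0 < c2) (hτ : 0 < τ)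
    (H1 : frobNorm (Ahat - Astar) + frobNorm (Bhat - Bstar) + frobNorm (Dhat - Dstar) ≤
      η * frobNorm (Chat - Cstar))
    (H2 : c2 * (frobNorm (Chat - Cstar)) ^ 2 ≤
      (n : ℝ)⁻¹ * (frobNorm (X * (Chat - Cstar))) ^ 2)
    (H3 : (n : ℝ)⁻¹ * (frobNorm (X * (Chat - Cstar))) ^ 2 ≤
      lam * (l1Norm (Dhat - Dstar) + l1Norm (Ahat - Astar) + l1Norm (Bhat - Bstar)))
    (H4D : Thresholded τ Dhat) (H4Ds : Thresholded τ Dstar)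
    (H4A : Thresholded τ Ahat) (H4As : Thresholded τ Astar)
    (H4B : Thresholded τ Bhat) (H4Bs : Thresholded τ Bstar)
    (H5 : lam ^ 2 * η ^ 4 / (c2 ^ 2 * τ ^ 2) < 1) :
    l1Norm (Dhat - Dstar) + l1Norm (Ahat - Astar) + l1Norm (Bhat - Bstar) ≤
        lam * η ^ 2 * ((l0Norm Dstar + l0Norm Astar + l0Norm Bstar : ℕ) : ℝ) /
          (c2 * (1 - lam ^ 2 * η ^ 4 / (c2 ^ 2 * τ ^ 2))) ∧
      (n : ℝ)⁻¹ * (frobNorm (X * (Chat - Cstar))) ^ 2 ≤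
        lam ^ 2 * η ^ 2 * ((l0Norm Dstar + l0Norm Astar + l0Norm Bstar : ℕ) : ℝ) /
          (c2 * (1 - lam ^ 2 * η ^ 4 / (c2 ^ 2 * τ ^ 2))) := by
  have hx : 0 < 1 - lam ^ 2 * η ^ 4 / (c2 ^ 2 * τ ^ 2) := by linarith
  have ht : 0 < lam * η ^ 2 / c2 := by positivity
  have kD := l1_key Dhat Dstar _ τ ht hτ H4D
  have kA := l1_key Ahat Astar _ τ ht hτ H4A
  have kB := l1_key Bhat Bstar _ τ ht hτ H4B
  have nD : 0 ≤ frobNorm (Dhat - Dstar) := Real.sqrt_nonneg _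
  have nA : 0 ≤ frobNorm (Ahat - Astar) := Real.sqrt_nonneg _
  have nB : 0 ≤ frobNorm (Bhat - Bstar) := Real.sqrt_nonneg _
  have main : l1Norm (Dhat - Dstar) + l1Norm (Ahat - Astar) + l1Norm (Bhat - Bstar) ≤
        lam * η ^ 2 * ((l0Norm Dstar + l0Norm Astar + l0Norm Bstar : ℕ) : ℝ) /
          (c2 * (1 - lam ^ 2 * η ^ 4 / (c2 ^ 2 * τ ^ 2))) := by
    have H23 := H2.trans H3
    push_cast
    generalize l1Norm (Dhat - Dstar) = d1 at *
    generalize l1Norm (Ahat - Astar) = a1 at *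
    generalize l1Norm (Bhat - Bstar) = b1 at *
    generalize frobNorm (Dhat - Dstar) = d2 at *
    generalize frobNorm (Ahat - Astar) = a2 at *
    generalize frobNorm (Bhat - Bstar) = b2 at *
    generalize frobNorm (Chat - Cstar) = f at *
    have hF1 : d2 ^ 2 + a2 ^ 2 + b2 ^ 2 ≤ (η * f) ^ 2 := by
      have : (a2 + b2 + d2) ^ 2 ≤ (η * f) ^ 2 := by gcongr
      nlinarith [mul_nonneg nA nB, mul_nonneg nA nD, mul_nonneg nB nD]
    have hF2 : (η * f) ^ 2 ≤ lam * η ^ 2 / c2 * (d1 + a1 + b1) := by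
      have h : f ^ 2 ≤ lam * (d1 + a1 + b1) / c2 := by
        rw [le_div_iff₀ hc2]; linarith
      calc (η * f) ^ 2 = η ^ 2 * f ^ 2 := by ring
        _ ≤ η ^ 2 * (lam * (d1 + a1 + b1) / c2) := by gcongr
        _ = _ := by ring
    have hF := hF1.trans hF2
    have hx' : lam ^ 2 * η ^ 4 / (c2 ^ 2 * τ ^ 2) = (lam * η ^ 2 / c2) ^ 2 / τ ^ 2 := by
      field_simp
    rw [hx'] at hx ⊢
    have e : lam * η ^ 2 * ((l0Norm Dstar : ℝ) + l0Norm Astar + l0Norm Bstar) /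
          (c2 * (1 - (lam * η ^ 2 / c2) ^ 2 / τ ^ 2)) =
        (lam * η ^ 2 / c2) * ((l0Norm Dstar : ℝ) + l0Norm Astar + l0Norm Bstar) /
          (1 - (lam * η ^ 2 / c2) ^ 2 / τ ^ 2) := by
      rw [← div_div]; congr 1; ring
    rw [e, le_div_iff₀ hx]
    generalize lam * η ^ 2 / c2 = t at *
    have h4 : (t / τ ^ 2 + 1 / t) * (d2 ^ 2 + a2 ^ 2 + b2 ^ 2) ≤
        (t / τ ^ 2 + 1 / t) * (t * (d1 + a1 + b1)) := by gcongr
    have h5 : (t / τ ^ 2 + 1 / t) * (t * (d1 + a1 + b1)) =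
        (t ^ 2 / τ ^ 2 + 1) * (d1 + a1 + b1) := by field_simp
    linarith
  refine ⟨main, H3.trans ?_⟩
  calc _ ≤ lam * _ := mul_le_mul_of_nonneg_left main hlam.le
    _ = _ := by ring
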